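/- Let C = (C_•, ∂_•) be a chain complex of left A-modules concentrated in non-negative degrees such that C_k = 0 for all but finitely many k, H_k(C) = 0 for all k ≠ 0, and each C_k is of type FP. Then H_0(C) = C_0 / im ∂_1 is of type FP. -/

import Mathlib

/-- A finite resolution `0 → P_m → P_{m−1} → ⋯ → P_1 → P_0 → M → 0` of the left
`A`-module `M` by finitely generated projective left `A`-modules.  (The modules `P_k`
for `k > m` are required to be trivial, so that the data `f_k : P_{k+1} → P_k`, the
augmentation `g : P_0 → M` and the exactness conditions encode exactly such a finite
exact sequence.)  A module is *of type FP* iff such a resolution exists. -/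
structure FiniteProjectiveResolution (A : Type u) [Ring A]
    (M : Type v) [AddCommGroup M] [Module A M] where
  m : ℕ
  P : ℕ → Type u
  [acg : ∀ k, AddCommGroup (P k)]
  [mod : ∀ k, Module A (P k)]
  fg : ∀ k, Module.Finite A (P k)
  proj : ∀ k, Module.Projective A (P k)
  triv : ∀ k, m < k → Subsingleton (P k)
  f : ∀ k, P (k + 1) →ₗ[A] P k
  g : P 0 →ₗ[A] M
  surj : Function.Surjective g
  exact0 : LinearMap.ker g = LinearMap.range (f 0)
  exact : ∀ k, LinearMap.ker (f k) = LinearMap.range (f (k + 1))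

/-- A left `A`-module `M` is of type FP if it admits a finite resolution by finitely
generated projective left `A`-modules. -/
def IsTypeFP (A : Type u) [Ring A] (M : Type v) [AddCommGroup M] [Module A M] : Prop :=
  Nonempty (FiniteProjectiveResolution A M)

universe u v w x

open LinearMap in
/-- A linear map out of a projective module lifts along any linear map whose range contains its
values. -/
theorem Module.Projective.exists_lift_of_forall_mem_range {A : Type*} [Ring A]
    {P M N : Type*} [AddCommGroup P] [Module A P] [Module.Projective A P]
    [AddCommGroup M] [Module A M] [AddCommGroup N] [Module A N]
    (q : M →ₗ[A] N) (h : P →ₗ[A] N) (hh : ∀ x, h x ∈ range q) :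
    ∃ φ : P →ₗ[A] M, ∀ x, q (φ x) = h x := by
  obtain ⟨φ, hφ⟩ := Module.projective_lifting_property q.rangeRestrict
    (h.codRestrict (range q) hh) q.surjective_rangeRestrict
  exact ⟨φ, fun x => congrArg Subtype.val (LinearMap.congr_fun hφ x)⟩

namespace FiniteProjectiveResolution

attribute [instance] acg mod fg proj

variable {A : Type u} [Ring A] {L : Type v} [AddCommGroup L] [Module A L]
  {M : Type w} [AddCommGroup M] [Module A M]

theorem g_f (R : FiniteProjectiveResolution A M) (x : R.P 1) : R.g (R.f 0 x) = 0 :=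
  LinearMap.mem_ker.1 (R.exact0 ▸ LinearMap.mem_range_self _ x)

theorem f_f (R : FiniteProjectiveResolution A M) (k : ℕ) (x : R.P (k + 2)) :
    R.f k (R.f (k + 1) x) = 0 :=
  LinearMap.mem_ker.1 (R.exact k ▸ LinearMap.mem_range_self _ x)

theorem exists_of_g_eq_zero (R : FiniteProjectiveResolution A M) {x : R.P 0} (hx : R.g x = 0) :
    ∃ y, R.f 0 y = x :=
  LinearMap.mem_range.1 (R.exact0 ▸ LinearMap.mem_ker.2 hx)

theorem exists_of_f_eq_zero (R : FiniteProjectiveResolution A M) {k : ℕ} {x : R.P (k + 1)}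
    (hx : R.f k x = 0) : ∃ y, R.f (k + 1) y = x :=
  LinearMap.mem_range.1 (R.exact k ▸ LinearMap.mem_ker.2 hx)

/-- A linear map lifts to a chain map between finite projective resolutions. -/
theorem exists_lift (R : FiniteProjectiveResolution A L) (S : FiniteProjectiveResolution A M)
    (f : L →ₗ[A] M) :
    ∃ φ : ∀ k, R.P k →ₗ[A] S.P k, (∀ x, S.g (φ 0 x) = f (R.g x)) ∧
      ∀ k x, S.f k (φ (k + 1) x) = φ k (R.f k x) := by
  obtain ⟨φ₀, hφ₀⟩ := Module.Projective.exists_lift_of_forall_mem_range S.g (f ∘ₗ R.g)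
    fun x => S.surj _
  let T (k : ℕ) := {φ : R.P k →ₗ[A] S.P k // ∀ x, φ (R.f k x) ∈ LinearMap.range (S.f k)}
  have step (k : ℕ) (φ : T k) : ∃ ψ : T (k + 1), ∀ x, S.f k (ψ.1 x) = φ.1 (R.f k x) := by
    obtain ⟨ψ, hψ⟩ := Module.Projective.exists_lift_of_forall_mem_range (S.f k)
      (φ.1 ∘ₗ R.f k) φ.2
    refine ⟨⟨ψ, fun x => S.exists_of_f_eq_zero ?_⟩, hψ⟩
    simp [hψ, f_f]
  choose next h_next using step
  let start : T 0 := ⟨φ₀, fun x => S.exists_of_g_eq_zero (by simp [hφ₀, g_f])⟩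
  let φ (k : ℕ) : T k := Nat.rec start next k
  exact ⟨fun k => (φ k).1, hφ₀, fun k => h_next k (φ k)⟩

/-- Extend a resolution of the kernel of a surjection from a finitely generated projective
module to a resolution of the target. -/
def cons {P₀ : Type u} [AddCommGroup P₀] [Module A P₀] [Module.Finite A P₀]
    [Module.Projective A P₀] (g : P₀ →ₗ[A] M) (hg : Function.Surjective g)
    (R : FiniteProjectiveResolution A (LinearMap.ker g)) : FiniteProjectiveResolution A M where
  m := R.m + 1
  P := fun k => Nat.casesOn k P₀ R.P
  acg := fun k => match k with
    | 0 => inferInstanceAs (AddCommGroup P₀)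
    | k + 1 => R.acg k
  mod := fun k => match k with
    | 0 => inferInstanceAs (Module A P₀)
    | k + 1 => R.mod k
  fg := fun k => match k with
    | 0 => inferInstanceAs (Module.Finite A P₀)
    | k + 1 => R.fg k
  proj := fun k => match k with
    | 0 => inferInstanceAs (Module.Projective A P₀)
    | k + 1 => R.proj k
  triv := fun k hk => match k with
    | 0 => absurd hk (by omega)
    | k + 1 => R.triv k (by omega)
  f := fun k => match k with
    | 0 => (LinearMap.ker g).subtype ∘ₗ R.g
    | k + 1 => R.f k
  g := g
  surj := hg
  exact0 := by
    change LinearMap.ker g = LinearMap.range ((LinearMap.ker g).subtype ∘ₗ R.g)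
    rw [LinearMap.range_comp_of_range_eq_top _ (LinearMap.range_eq_top.2 R.surj),
      Submodule.range_subtype]
  exact := fun k => match k with
    | 0 => by
      change LinearMap.ker ((LinearMap.ker g).subtype ∘ₗ R.g) = LinearMap.range (R.f 0)
      rw [LinearMap.ker_comp_of_ker_eq_bot _ (Submodule.ker_subtype _), R.exact0]
    | k + 1 => R.exact k

/-- The trivial resolution of a trivial module. -/
def ofSubsingleton [Subsingleton M] : FiniteProjectiveResolution A M where
  m := 0
  P := fun _ => PUnit
  fg := fun _ => inferInstance
  proj := fun _ => inferInstance
  triv := fun _ _ => inferInstance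
  f := fun _ => 0
  g := 0
  surj := fun _ => ⟨0, Subsingleton.elim _ _⟩
  exact0 := Subsingleton.elim _ _
  exact := fun _ => Subsingleton.elim _ _

end FiniteProjectiveResolution

open FiniteProjectiveResolution in
/-- The cokernel of an injection between modules of type FP is of type FP: it is resolved by the
mapping cone of a lift of the injection to resolutions. -/
theorem IsTypeFP.of_shortExact {A : Type u} [Ring A] {L : Type v} [AddCommGroup L] [Module A L]
    {M : Type w} [AddCommGroup M] [Module A M] {N : Type x} [AddCommGroup N] [Module A N]
    (hL : IsTypeFP A L) (hM : IsTypeFP A M) (i : L →ₗ[A] M) (p : M →ₗ[A] N)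
    (hi : Function.Injective i) (hp : Function.Surjective p)
    (hip : LinearMap.ker p = LinearMap.range i) : IsTypeFP A N := by
  obtain ⟨R⟩ := hL
  obtain ⟨S⟩ := hM
  obtain ⟨φ, hφ₀, hφ⟩ := R.exists_lift S i
  have hpi (y : L) : p (i y) = 0 := LinearMap.mem_ker.1 (hip ▸ LinearMap.mem_range_self _ y)
  let aug : (S.P 1 × R.P 0) →ₗ[A] LinearMap.ker (p ∘ₗ S.g) :=
    ((S.f 0).coprod (φ 0)).codRestrict _ fun x => by simp [g_f, hφ₀, hpi]
  have h_aug (x : S.P 1) (y : R.P 0) : (aug (x, y)).1 = S.f 0 x + φ 0 y := rfl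
  let δ (k : ℕ) : (S.P (k + 2) × R.P (k + 1)) →ₗ[A] (S.P (k + 1) × R.P k) :=
    ((S.f (k + 1)).coprod (φ (k + 1))).prod (-(R.f k ∘ₗ LinearMap.snd A _ _))
  refine ⟨cons (p ∘ₗ S.g) (hp.comp S.surj)
    { m := S.m + R.m
      P := fun k => S.P (k + 1) × R.P k
      fg := fun k => inferInstance
      proj := fun k => inferInstance
      triv := fun k hk => ?_
      f := δ
      g := aug
      surj := ?_
      exact0 := ?_
      exact := fun k => ?_ }⟩
  · have := S.triv (k + 1) (by omega)
    have := R.triv k (by omega)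
    infer_instance
  · rintro ⟨a, ha⟩
    have ha' : S.g a ∈ LinearMap.ker p := ha
    rw [hip] at ha'
    obtain ⟨l, hl⟩ := ha'
    obtain ⟨y, rfl⟩ := R.surj l
    obtain ⟨x, hx⟩ := S.exists_of_g_eq_zero (x := a - φ 0 y) (by simp [hφ₀, hl])
    exact ⟨(x, y), Subtype.ext ((h_aug x y).trans (by simp [hx]))⟩
  · refine le_antisymm ?_ ?_
    · rintro ⟨x, y⟩ hxy
      have h : S.f 0 x + φ 0 y = 0 := congrArg Subtype.val (LinearMap.mem_ker.1 hxy)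
      have hy : R.g (-y) = 0 := hi <| by
        have := congrArg S.g h
        simp only [map_add, g_f, hφ₀, zero_add, map_zero] at this
        simp [this]
      obtain ⟨z, hz⟩ := R.exists_of_g_eq_zero hy
      obtain ⟨t, ht⟩ := S.exists_of_f_eq_zero (x := x - φ 1 z) (by simp [hφ, hz, h])
      exact ⟨(t, z), by simp [δ, ht, hz]⟩
    · rintro _ ⟨⟨t, z⟩, rfl⟩
      exact LinearMap.mem_ker.2 (Subtype.ext ((h_aug _ _).trans (by simp [f_f, hφ])))
  · refine le_antisymm ?_ ?_
    · rintro ⟨x, y⟩ hxy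
      obtain ⟨h, hy⟩ : S.f (k + 1) x + φ (k + 1) y = 0 ∧ R.f k y = 0 := by
        simpa [δ] using hxy
      obtain ⟨z, hz⟩ := R.exists_of_f_eq_zero (x := -y) (by simp [hy])
      obtain ⟨t, ht⟩ := S.exists_of_f_eq_zero (x := x - φ (k + 2) z) (by simp [hφ, hz, h])
      exact ⟨(t, z), by simp [δ, ht, hz]⟩
    · rintro _ ⟨⟨t, z⟩, rfl⟩
      exact LinearMap.mem_ker.2 (by simp [δ, f_f, hφ])

/-- Let `A` be an associative unital ring and let `C = (C_•, ∂_•)` be a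
chain complex of left `A`-modules concentrated in non-negative degrees (here `∂_{k+1}` is
`d k : C (k+1) → C k`) such that `C_k = 0` for all but finitely many `k`, `H_k(C) = 0` for
all `k ≠ 0` (i.e. `ker ∂_{k+1} = im ∂_{k+2}` for all `k ≥ 0`), and each `C_k` is of
type FP.  Then `H_0(C) = C_0 / im ∂_1` is of type FP. -/
theorem typeFP_of_acyclic_complex (A : Type*) [Ring A]
    (C : ℕ → Type*) [∀ k, AddCommGroup (C k)] [∀ k, Module A (C k)]
    (d : ∀ k, C (k + 1) →ₗ[A] C k)
    (hcomplex : ∀ k, (d k).comp (d (k + 1)) = 0)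
    (N : ℕ) (hbound : ∀ k, N < k → Subsingleton (C k))
    (hacyclic : ∀ k, LinearMap.ker (d k) = LinearMap.range (d (k + 1)))
    (hFP : ∀ k, IsTypeFP A (C k)) :
    IsTypeFP A (C 0 ⧸ LinearMap.range (d 0)) := by
  have hrange (j : ℕ) : ∀ k, N ≤ k + j → IsTypeFP A (LinearMap.range (d k)) := by
    induction j with
    | zero =>
      intro k hk
      have := hbound (k + 1) (by omega)
      have : Subsingleton (LinearMap.range (d k)) :=
        (d k).surjective_rangeRestrict.subsingleton
      exact ⟨.ofSubsingleton⟩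
    | succ j ih =>
      intro k hk
      exact (ih (k + 1) (by omega)).of_shortExact (hFP (k + 1)) (Submodule.subtype _)
        (d k).rangeRestrict (Submodule.subtype_injective _) (d k).surjective_rangeRestrict
        (by rw [LinearMap.ker_rangeRestrict, Submodule.range_subtype, hacyclic])
  exact (hrange N 0 (by omega)).of_shortExact (hFP 0) (Submodule.subtype _)
    (Submodule.mkQ _) (Submodule.subtype_injective _) (Submodule.mkQ_surjective _)
    (by rw [Submodule.ker_mkQ, Submodule.range_subtype])
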